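/- Let n and r be natural numbers with 2·r < n and let V denote the type Fin n → Bool. There exists a function Rec : (V → Bool) → V → Option V with the following property: for every x : V, letting E_x : V → Bool be defined by E_x ζ = decide (hammingDist x ζ ≤ r), and for every x' : V, one has Rec E_x x' = some x whenever hammingDist x x' ≤ r, and Rec E_x x' = none whenever hammingDist x x' > r. -/

import Mathlib

/-- A Hamming ball of radius `r < card ι` in the Boolean cube is not contained in the ball of the
same radius around another point. -/
theorem exists_hammingDist_le_and_lt {ι : Type*} [Fintype ι] [DecidableEq ι] {r : ℕ}
    (hr : r < Fintype.card ι) {x y : ι → Bool} (hxy : x ≠ y) :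
    ∃ z : ι → Bool, hammingDist x z ≤ r ∧ r < hammingDist y z := by
  have hpos : 0 < hammingDist x y := hammingDist_pos.2 hxy
  set D : Finset ι := {i | x i ≠ y i} with hD
  have hDcard : D.card = hammingDist x y := rfl
  obtain ⟨T, hTD, hT⟩ := Finset.exists_subset_card_eq (min_le_right r Dᶜ.card)
  have hx : hammingDist x (fun i => if i ∈ T then !x i else x i) = T.card := by
    unfold hammingDist
    congr 1
    ext i
    by_cases hi : i ∈ T <;> simp [hi]
  have hy : hammingDist y (fun i => if i ∈ T then !x i else x i) = D.card + T.card := by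
    rw [← Finset.card_union_of_disjoint
      (Finset.disjoint_left.2 fun i hiD hiT => Finset.mem_compl.1 (hTD hiT) hiD)]
    unfold hammingDist
    congr 1
    ext i
    by_cases hi : i ∈ T
    · have hxyi : x i = y i := by simpa [hD] using hTD hi
      simp [hi, hxyi]
    · simp [hi, hD, eq_comm]
  have hcompl := D.card_add_card_compl
  exact ⟨fun i => if i ∈ T then !x i else x i, by omega, by omega⟩

/-- A Hamming ball of radius `r < card ι` in the Boolean cube determines its center. -/
theorem hammingBall_indicator_injective {ι : Type*} [Fintype ι] {r : ℕ}
    (hr : r < Fintype.card ι) :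
    Function.Injective fun (x z : ι → Bool) => decide (hammingDist x z ≤ r) := by
  classical
  intro x y h
  by_contra hxy
  obtain ⟨z, hxz, hyz⟩ := exists_hammingDist_le_and_lt hr hxy
  have hz := congrFun h z
  simp only [decide_eq_decide] at hz
  exact hyz.not_ge (hz.1 hxz)

/-- Difference recovery from the Hamming ball indicator: when `2r < n`, there is a recovery
procedure which, given the radius-`r` ball indicator of `x` and a point `x'` in the clear,
returns `x` whenever `hammingDist x x' ≤ r` and `none` whenever `hammingDist x x' > r`. -/
theorem hamming_difference_recovery (n r : ℕ) (hrn : 2 * r < n) :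
    ∃ Rec : ((Fin n → Bool) → Bool) → (Fin n → Bool) → Option (Fin n → Bool),
      ∀ x x' : Fin n → Bool,
        (hammingDist x x' ≤ r →
          Rec (fun ζ => decide (hammingDist x ζ ≤ r)) x' = some x) ∧
        (r < hammingDist x x' →
          Rec (fun ζ => decide (hammingDist x ζ ≤ r)) x' = none) := by
  have hinj := hammingBall_indicator_injective (ι := Fin n) (r := r)
    (by rw [Fintype.card_fin]; omega)
  refine ⟨fun E x' => if E x' then some (Function.invFun
    (fun (x z : Fin n → Bool) => decide (hammingDist x z ≤ r)) E) else none, fun x x' => ⟨?_, ?_⟩⟩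
  · intro h
    simpa [h] using Function.leftInverse_invFun hinj x
  · intro h
    simp [h]
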